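/- arXiv:1910.05919 — 2 statements merged into one kernel-verified Lean document; each statement's English description precedes it below -/
import Mathlib

section
/- Integral Descartes quadruples from two integer vectors: let a₁, a₂, b₁, b₂ ∈ ℤ and set p = a₁² + a₂², q = b₁² + b₂², s = a₁b₁ + a₂b₂, w = a₁b₂ − a₂b₁. Define A = q + s, B = p + s, C = −s, and D = p + q + s + 2w (or D = p + q + s − 2w). Then the Descartes equation 2·(A² + B² + C² + D²) = (A + B + C + D)² holds for both choices of D. -/
theorem integral_descartes_from_two_integer_vectors
    (a₁ a₂ b₁ b₂ : ℤ) :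
    let p := a₁ ^ 2 + a₂ ^ 2
    let q := b₁ ^ 2 + b₂ ^ 2
    let s := a₁ * b₁ + a₂ * b₂
    let w := a₁ * b₂ - a₂ * b₁
    let A := q + s
    let B := p + s
    let C := -s
    (2 * (A ^ 2 + B ^ 2 + C ^ 2 + (p + q + s + 2 * w) ^ 2) =
        (A + B + C + (p + q + s + 2 * w)) ^ 2) ∧
      (2 * (A ^ 2 + B ^ 2 + C ^ 2 + (p + q + s - 2 * w) ^ 2) =
        (A + B + C + (p + q + s - 2 * w)) ^ 2) := by
  dsimp only
  constructor <;> ring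
end

section
/- Descartes quadruples from a sum-zero triple of spinors: let a, b, c ∈ ℂ with a + b + c = 0, and define A = −(b ⋅ c), B = −(c ⋅ a), C = −(a ⋅ b), D₁ = A + B + C + 2·(a × b), D₂ = A + B + C − 2·(a × b). Then 2·(A² + B² + C² + D₁²) = (A + B + C + D₁)² and 2·(A² + B² + C² + D₂²) = (A + B + C + D₂)², and moreover D₁ + D₂ = a⋅a + b⋅b + c⋅c. -/
/-- Inner product of two complex numbers viewed as plane vectors. -/
def cdot (u v : ℂ) : ℝ := ((starRingEnd ℂ) u * v).re

/-- Symplectic product of two complex numbers viewed as plane vectors. -/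
def cross (u v : ℂ) : ℝ := ((starRingEnd ℂ) u * v).im

theorem descartes_from_sum_zero_spinors
    (a b c : ℂ) (h : a + b + c = 0) :
    let A := -(cdot b c)
    let B := -(cdot c a)
    let C := -(cdot a b)
    let D₁ := A + B + C + 2 * cross a b
    let D₂ := A + B + C - 2 * cross a b
    (2 * (A ^ 2 + B ^ 2 + C ^ 2 + D₁ ^ 2) = (A + B + C + D₁) ^ 2) ∧
      (2 * (A ^ 2 + B ^ 2 + C ^ 2 + D₂ ^ 2) = (A + B + C + D₂) ^ 2) ∧
      D₁ + D₂ = cdot a a + cdot b b + cdot c c := by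
  obtain rfl : c = -a - b := by linear_combination h
  simp only [cdot, cross, Complex.mul_re, Complex.mul_im, Complex.conj_re, Complex.conj_im,
    Complex.sub_re, Complex.sub_im, Complex.neg_re, Complex.neg_im]
  refine ⟨?_, ?_, ?_⟩ <;> ring
end
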